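/- Let G be a 2-connected non-bipartite graph. Then the following are equivalent: (i) any two odd circuits of G share an odd number of edges; (ii) G has a totally odd circuit basis; (iii) every odd cycle basis of G is totally odd. -/

import Mathlib

open SimpleGraph

variable {V : Type*}

/-- A graph is 2-connected: connected, at least 3 vertices, and deleting any
vertex keeps it connected. -/
def TwoConnected (G : SimpleGraph V) : Prop :=
  G.Connected ∧ 3 ≤ Nat.card V ∧
    ∀ v : V, ((⊤ : G.Subgraph).deleteVerts {v}).coe.Connected

/-- A graph is non-bipartite iff it has an odd circuit. -/
def HasOddCircuit (G : SimpleGraph V) : Prop :=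
  ∃ (u : V) (c : G.Walk u u), c.IsCycle ∧ Odd c.length

/-- `G` contains a totally odd subdivision of `C3+` (triangle with a doubled
edge): equivalently, the union of an odd circuit and an odd path having exactly
its two distinct endpoints on the circuit. -/
def ContainsOddC3Plus (G : SimpleGraph V) : Prop :=
  ∃ (x : V) (c : G.Walk x x) (a b : V) (p : G.Walk a b),
    c.IsCycle ∧ Odd c.length ∧ p.IsPath ∧ Odd p.length ∧ a ≠ b ∧
    a ∈ c.support ∧ b ∈ c.support ∧
    ∀ w ∈ p.support, w ∈ c.support → w = a ∨ w = b

section Space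
variable [Fintype V] [DecidableEq V]

/-- `C` is the edge set of a circuit of `G`. -/
def IsCircuitSet (G : SimpleGraph V) (C : Finset (Sym2 V)) : Prop :=
  ∃ (u : V) (c : G.Walk u u), c.IsCycle ∧ C = c.edges.toFinset

/-- incidence vector over `𝔽₂` of a set of edges -/
def edgeInd (C : Finset (Sym2 V)) : Sym2 V → ZMod 2 :=
  fun e => if e ∈ C then 1 else 0

/-- the cycle space of `G`: the `𝔽₂`-span of incidence vectors of circuits -/
def cycleSpace (G : SimpleGraph V) : Submodule (ZMod 2) (Sym2 V → ZMod 2) :=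
  Submodule.span (ZMod 2) {x | ∃ C, IsCircuitSet G C ∧ x = edgeInd C}

/-- `C` is a cycle of `G` (an element of the cycle space). -/
def IsCycleSet (G : SimpleGraph V) (C : Finset (Sym2 V)) : Prop :=
  edgeInd C ∈ cycleSpace G

/-- `B` is a cycle basis of `G`: a family of cycles whose incidence vectors
form a basis of the cycle space. -/
def IsCycleBasis (G : SimpleGraph V) (B : Finset (Finset (Sym2 V))) : Prop :=
  (∀ C ∈ B, IsCycleSet G C) ∧
  LinearIndependent (ZMod 2) (fun C : B => edgeInd C.1) ∧
  Submodule.span (ZMod 2) (edgeInd '' (B : Set (Finset (Sym2 V)))) = cycleSpace G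

end Space

/-- data of a potential ear: two endpoints and a walk between them -/
abbrev EarData (G : SimpleGraph V) := Σ a : V, Σ b : V, G.Walk a b

/-- the union of a base circuit and a list of ears, as a subgraph -/
def earsUnion {G : SimpleGraph V} {x : V} (base : G.Walk x x)
    (ears : List (EarData G)) : G.Subgraph :=
  ears.foldl (fun H e => H ⊔ e.2.2.toSubgraph) base.toSubgraph

/-- `e` is an ear of the subgraph `H`: a path with exactly its two distinct
endpoints in `H`, all edges new. -/
def IsEar {G : SimpleGraph V} (H : G.Subgraph) (e : EarData G) : Prop :=
  e.2.2.IsPath ∧ e.1 ≠ e.2.1 ∧ e.1 ∈ H.verts ∧ e.2.1 ∈ H.verts ∧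
  (∀ v ∈ e.2.2.support, v ≠ e.1 → v ≠ e.2.1 → v ∉ H.verts) ∧
  ∀ ed ∈ e.2.2.edges, ed ∉ H.edgeSet

/-- an (open) ear-decomposition of `G` -/
structure EarDecomposition (G : SimpleGraph V) where
  x : V
  base : G.Walk x x
  base_cycle : base.IsCycle
  ears : List (EarData G)
  ear_cond : ∀ i (h : i < ears.length),
    IsEar (earsUnion base (ears.take i)) (ears.get ⟨i, h⟩)
  union_top : earsUnion base ears = ⊤

/-- an ear-decomposition is odd if the base circuit and all ears are odd -/
def EarDecomposition.IsOdd {G : SimpleGraph V} (ed : EarDecomposition G) : Prop :=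
  Odd ed.base.length ∧ ∀ e ∈ ed.ears, Odd e.2.2.length

/-- `G` is a totally odd subdivision of `K₄`. -/
def IsTotallyOddK4 (G : SimpleGraph V) : Prop :=
  ∃ (b : Fin 4 → V) (p : ∀ i j : Fin 4, i < j → G.Walk (b i) (b j)),
    Function.Injective b ∧
    (∀ i j h, (p i j h).IsPath ∧ Odd (p i j h).length) ∧
    (∀ i j h i' j' h', (i, j) ≠ (i', j') →
      ∀ v ∈ (p i j h).support, v ∈ (p i' j' h').support →
        (v = b i ∨ v = b j) ∧ (v = b i' ∨ v = b j')) ∧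
    (⨆ i, ⨆ j, ⨆ h : i < j, (p i j h).toSubgraph) = ⊤

/-- `G` contains a totally odd subdivision of `K₄` as a subgraph. -/
def ContainsTotallyOddK4 (G : SimpleGraph V) : Prop :=
  ∃ (b : Fin 4 → V) (p : ∀ i j : Fin 4, i < j → G.Walk (b i) (b j)),
    Function.Injective b ∧
    (∀ i j h, (p i j h).IsPath ∧ Odd (p i j h).length) ∧
    (∀ i j h i' j' h', (i, j) ≠ (i', j') →
      ∀ v ∈ (p i j h).support, v ∈ (p i' j' h').support →
        (v = b i ∨ v = b j) ∧ (v = b i' ∨ v = b j'))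

/-- `G` contains an odd theta subgraph through the vertex `w`: three pairwise
internally disjoint and edge-disjoint odd paths with the same distinct ends,
one of them passing through `w`. -/
def ContainsOddThetaThrough (G : SimpleGraph V) (w : V) : Prop :=
  ∃ (x y : V) (p1 p2 p3 : G.Walk x y), x ≠ y ∧
    p1.IsPath ∧ p2.IsPath ∧ p3.IsPath ∧
    Odd p1.length ∧ Odd p2.length ∧ Odd p3.length ∧
    (∀ v ∈ p1.support, v ∈ p2.support → v = x ∨ v = y) ∧
    (∀ v ∈ p1.support, v ∈ p3.support → v = x ∨ v = y) ∧
    (∀ v ∈ p2.support, v ∈ p3.support → v = x ∨ v = y) ∧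
    (∀ e ∈ p1.edges, e ∉ p2.edges) ∧
    (∀ e ∈ p1.edges, e ∉ p3.edges) ∧
    (∀ e ∈ p2.edges, e ∉ p3.edges) ∧
    (w ∈ p1.support ∨ w ∈ p2.support ∨ w ∈ p3.support)

/-- a graph is factor-critical if deleting any vertex leaves a graph with a
perfect matching -/
def FactorCritical {W : Type*} (H : SimpleGraph W) : Prop :=
  ∀ v : W, ∃ M : ((⊤ : H.Subgraph).deleteVerts {v}).coe.Subgraph,
    M.IsPerfectMatching

theorem edgeInd_toFinset [DecidableEq V] {l : List (Sym2 V)} (hl : l.Nodup) :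
    edgeInd l.toFinset = fun e => (l.count e : ZMod 2) := by
  funext e
  by_cases he : e ∈ l
  · simp [edgeInd, he, List.count_eq_one_of_mem hl he]
  · simp [edgeInd, he, List.count_eq_zero_of_not_mem he]

theorem edgeInd_injective [DecidableEq V] : Function.Injective (edgeInd (V := V)) := by
  intro C D h
  ext e
  have := congrFun h e
  by_cases h1 : e ∈ C <;> by_cases h2 : e ∈ D <;> simp_all [edgeInd]

namespace SimpleGraph.Walk

variable {G : SimpleGraph V}

theorem IsPath.append_of_forall_eq {u v w : V} {p : G.Walk u v} {q : G.Walk v w}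
    (hp : p.IsPath) (hq : q.IsPath) (h : ∀ x ∈ p.support, x ∈ q.support → x = v) :
    (p.append q).IsPath := by
  rw [isPath_def, support_append, List.nodup_append']
  refine ⟨hp.support_nodup, hq.support_nodup.tail, ?_⟩
  intro x hx hx'
  obtain rfl := h x hx (List.mem_of_mem_tail hx')
  have := hq.support_nodup
  rw [← cons_tail_support, List.nodup_cons] at this
  exact this.1 hx'

theorem IsPath.start_notMem_tail_support {u v : V} {p : G.Walk u v} (hp : p.IsPath) :
    u ∉ p.support.tail := by
  have := hp.support_nodup
  rw [← cons_tail_support, List.nodup_cons] at this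
  exact this.1

theorem IsPath.eq_of_mem_takeUntil_of_mem_dropUntil [DecidableEq V] {u v w x : V}
    {p : G.Walk u v} (hp : p.IsPath) (hw : w ∈ p.support)
    (h₁ : x ∈ (p.takeUntil w hw).support) (h₂ : x ∈ (p.dropUntil w hw).support) : x = w := by
  by_contra hne
  have : ((p.takeUntil w hw).append (p.dropUntil w hw)).IsPath := by rwa [take_spec]
  exact this.ne_of_mem_support_of_append hne h₁ h₂ rfl

theorem mem_takeUntil_or_mem_takeUntil [DecidableEq V] {u v a b : V} (p : G.Walk u v)
    (ha : a ∈ p.support) (hb : b ∈ p.support) :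
    a ∈ (p.takeUntil b hb).support ∨ b ∈ (p.takeUntil a ha).support := by
  induction p with
  | nil =>
    rw [support_nil, List.mem_singleton] at ha hb
    subst ha hb
    simp
  | @cons u v w huv p ih =>
    by_cases hau : u = a
    · subst hau
      exact Or.inl (start_mem_support _)
    by_cases hbu : u = b
    · subst hbu
      exact Or.inr (start_mem_support _)
    have ha' : a ∈ p.support := by simpa [Ne.symm hau] using ha
    have hb' : b ∈ p.support := by simpa [Ne.symm hbu] using hb
    rw [takeUntil_cons hb' hbu, takeUntil_cons ha' hau]
    simpa [Ne.symm hau, Ne.symm hbu] using ih ha' hb'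

/-- Two internally disjoint paths between the same distinct ends, of different parity, form a
cycle. -/
theorem IsPath.isCycle_append_of_odd {a b : V} {p : G.Walk a b} {q : G.Walk b a}
    (hp : p.IsPath) (hq : q.IsPath) (hab : a ≠ b) (hodd : Odd (p.length + q.length))
    (h : ∀ x ∈ p.support, x ∈ q.support → x = a ∨ x = b) : (p.append q).IsCycle := by
  refine hp.isCycle_append hq ?_ ?_
  · intro x hx hx'
    rcases h x (List.mem_of_mem_tail hx) (List.mem_of_mem_tail hx') with rfl | rfl
    · exact hp.start_notMem_tail_support hx
    · exact hq.start_notMem_tail_support hx'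
  · have h1 : p.length ≠ 0 := fun h0 => hab (eq_of_length_eq_zero h0)
    have h2 : q.length ≠ 0 := fun h0 => hab (eq_of_length_eq_zero h0).symm
    obtain ⟨k, hk⟩ := hodd
    omega

/-- Every edge of the walk `p` joins vertices of different colours under `f`. -/
def ProperlyColored (f : V → ZMod 2) {u v : V} (p : G.Walk u v) : Prop :=
  ∀ x y, s(x, y) ∈ p.edges → f x = f y + 1

theorem ProperlyColored.of_subset {f : V → ZMod 2} {u v u' v' : V} {p : G.Walk u v}
    {q : G.Walk u' v'} (hp : p.ProperlyColored f) (h : q.edges ⊆ p.edges) :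
    q.ProperlyColored f :=
  fun x y hxy => hp x y (h hxy)

theorem ProperlyColored.length_eq {f : V → ZMod 2} {u v : V} {p : G.Walk u v}
    (h : p.ProperlyColored f) : (p.length : ZMod 2) = f u + f v := by
  induction p with
  | nil => simp [CharTwo.add_self_eq_zero]
  | @cons u v w huv p ih =>
    have h1 := ih (h.of_subset (by simp [edges_cons]))
    have h2 : f u = f v + 1 := h u v (by simp)
    rw [length_cons, Nat.cast_add, h1, h2]
    push_cast
    ring

/-- A colouring can be changed on a path, except at its end, to be proper along that path. -/
theorem IsPath.exists_properlyColored [DecidableEq V] {u v : V} {p : G.Walk u v} (hp : p.IsPath)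
    (f : V → ZMod 2) :
    ∃ f' : V → ZMod 2, (∀ x, x ∉ p.support ∨ x = v → f' x = f x) ∧ p.ProperlyColored f' := by
  induction p with
  | nil => exact ⟨f, fun _ _ => rfl, by simp [ProperlyColored]⟩
  | @cons u v w huv p ih =>
    rw [cons_isPath_iff] at hp
    obtain ⟨f', h1, h2⟩ := ih hp.1
    refine ⟨Function.update f' u (f' v + 1), ?_, ?_⟩
    · intro x hx
      have hxu : x ≠ u := by
        rintro rfl
        rcases hx with hx | rfl
        · simp at hx
        · exact hp.2 p.end_mem_support
      rw [Function.update_of_ne hxu]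
      apply h1
      rcases hx with hx | hx
      · left
        intro hx'
        exact hx (by simp [hx'])
      · exact Or.inr hx
    · intro x y hxy
      rw [edges_cons, List.mem_cons] at hxy
      have hvu : v ≠ u := huv.ne'
      rcases hxy with hxy | hxy
      · rw [Sym2.eq_iff] at hxy
        rcases hxy with ⟨rfl, rfl⟩ | ⟨rfl, rfl⟩
        · simp [Function.update_of_ne hvu]
        · rw [Function.update_self, Function.update_of_ne hvu, add_assoc,
            CharTwo.add_self_eq_zero, add_zero]
      · have hxu : x ≠ u := by
          rintro rfl
          exact hp.2 (p.fst_mem_support_of_mem_edges hxy)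
        have hyu : y ≠ u := by
          rintro rfl
          exact hp.2 (p.snd_mem_support_of_mem_edges hxy)
        rw [Function.update_of_ne hxu, Function.update_of_ne hyu]
        exact h2 x y hxy

theorem IsCycle.exists_properlyColored [DecidableEq V] {u : V} {c : G.Walk u u} (hc : c.IsCycle)
    (heven : Even c.length) : ∃ f : V → ZMod 2, c.ProperlyColored f := by
  cases c with
  | nil => exact ⟨0, by simp [ProperlyColored]⟩
  | @cons _ v _ huv p =>
    rw [cons_isCycle_iff] at hc
    obtain ⟨f, -, hf⟩ := hc.1.exists_properlyColored 0
    refine ⟨f, ?_⟩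
    have hlen := hf.length_eq
    have hodd : (p.length : ZMod 2) = 1 := by
      rw [length_cons, Nat.even_add_one, Nat.not_even_iff_odd] at heven
      exact ZMod.natCast_eq_one_iff_odd.mpr heven
    have huv' : f u = f v + 1 := by
      rw [hodd] at hlen
      rw [hlen, ← add_assoc, CharTwo.add_self_eq_zero, zero_add]
    intro x y hxy
    rw [edges_cons, List.mem_cons] at hxy
    rcases hxy with hxy | hxy
    · rw [Sym2.eq_iff] at hxy
      rcases hxy with ⟨rfl, rfl⟩ | ⟨rfl, rfl⟩
      · exact huv'
      · rw [huv', add_assoc, CharTwo.add_self_eq_zero, add_zero]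
    · exact hf x y hxy

/-- `p` is a path inside `W` that meets `T` exactly in its last vertex, and whose parity agrees
with the colouring `f`. -/
structure IsArm (f : V → ZMod 2) (W T : Set V) {a t : V} (p : G.Walk a t) : Prop where
  isPath : p.IsPath
  subset : ∀ x ∈ p.support, x ∈ W
  end_mem : t ∈ T
  eq_end : ∀ x ∈ p.support, x ∈ T → x = t
  length_eq : (p.length : ZMod 2) = f a + f t

theorem IsArm.nil {f : V → ZMod 2} {W T : Set V} {a : V} (hW : a ∈ W) (hT : a ∈ T) :
    (Walk.nil : G.Walk a a).IsArm f W T where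
  isPath := IsPath.nil
  subset := by simpa using hW
  end_mem := hT
  eq_end := by simp
  length_eq := by simp [CharTwo.add_self_eq_zero]

theorem IsArm.append {f f' : V → ZMod 2} {W W' T : Set V} {a z t : V} {r : G.Walk a z}
    {p : G.Walk z t} (hr : r.IsArm f' W' W) (hp : p.IsArm f W T) (hWW' : W ⊆ W') (hTW : T ⊆ W)
    (hff' : ∀ x ∈ W, f' x = f x) : (r.append p).IsArm f' W' T where
  isPath := hr.isPath.append_of_forall_eq hp.isPath
    fun x hx hx' => hr.eq_end x hx (hp.subset x hx')
  subset x hx := by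
    rw [mem_support_append_iff] at hx
    exact hx.elim (hr.subset x) fun h => hWW' (hp.subset x h)
  end_mem := hp.end_mem
  eq_end x hx hxT := by
    rw [mem_support_append_iff] at hx
    rcases hx with hx | hx
    · obtain rfl := hr.eq_end x hx (hTW hxT)
      exact hp.eq_end _ p.start_mem_support hxT
    · exact hp.eq_end x hx hxT
  length_eq := by
    rw [length_append, Nat.cast_add, hr.length_eq, hp.length_eq,
      hff' z hr.end_mem, hff' t (hTW hp.end_mem)]
    linear_combination f z * (CharTwo.two_eq_zero : (2 : ZMod 2) = 0)

end SimpleGraph.Walk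

namespace SimpleGraph

variable {G : SimpleGraph V}

/-- `a` and `b` are joined to `T` by disjoint arms inside `W`. -/
def HasArms (G : SimpleGraph V) (f : V → ZMod 2) (W T : Set V) (a b : V) : Prop :=
  ∃ (s t : V) (p : G.Walk a s) (q : G.Walk b t),
    p.IsArm f W T ∧ q.IsArm f W T ∧ p.support.Disjoint q.support

theorem HasArms.symm {f : V → ZMod 2} {W T : Set V} {a b : V} (h : G.HasArms f W T a b) :
    G.HasArms f W T b a := by
  obtain ⟨s, t, p, q, hp, hq, hd⟩ := h
  exact ⟨t, s, q, p, hq, hp, hd.symm⟩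

theorem HasArms.trans {f f' : V → ZMod 2} {W W' T : Set V} {a b : V}
    (h : G.HasArms f' W' W a b) (hW : ∀ a ∈ W, ∀ b ∈ W, a ≠ b → G.HasArms f W T a b)
    (hWW' : W ⊆ W') (hTW : T ⊆ W) (hff' : ∀ x ∈ W, f' x = f x) : G.HasArms f' W' T a b := by
  obtain ⟨y, z, r, s, hr, hs, hrs⟩ := h
  have hyz : y ≠ z := by
    rintro rfl
    exact hrs r.end_mem_support s.end_mem_support
  obtain ⟨t, t', p, q, hp, hq, hpq⟩ := hW y hr.end_mem z hs.end_mem hyz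
  refine ⟨t, t', r.append p, s.append q, hr.append hp hWW' hTW hff',
    hs.append hq hWW' hTW hff', ?_⟩
  intro x hx hx'
  rw [Walk.mem_support_append_iff] at hx hx'
  rcases hx with hx | hx <;> rcases hx' with hx' | hx'
  · exact hrs hx hx'
  · obtain rfl := hr.eq_end x hx (hq.subset x hx')
    exact hpq p.start_mem_support hx'
  · obtain rfl := hs.eq_end x hx' (hp.subset x hx)
    exact hpq hx q.start_mem_support
  · exact hpq hx hx'

section Ear

variable [DecidableEq V] {f : V → ZMod 2} {W : Set V} {c d : V} {p : G.Walk c d}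

theorem Walk.IsPath.isArm_takeUntil_reverse (hp : p.IsPath)
    (hf : p.ProperlyColored f) (hc : c ∈ W)
    (hW : ∀ x ∈ p.support, x ∈ W → x = c ∨ x = d) {a : V} (ha : a ∈ p.support) (had : a ≠ d) :
    (p.takeUntil a ha).reverse.IsArm f (W ∪ {x | x ∈ p.support}) W where
  isPath := (hp.takeUntil ha).reverse
  subset x hx := by
    rw [Walk.support_reverse, List.mem_reverse] at hx
    exact Or.inr (p.support_takeUntil_subset_support ha hx)
  end_mem := hc
  eq_end x hx hxW := by
    rw [Walk.support_reverse, List.mem_reverse] at hx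
    refine (hW x (p.support_takeUntil_subset_support ha hx) hxW).resolve_right ?_
    rintro rfl
    exact Walk.endpoint_notMem_support_takeUntil hp ha had.symm hx
  length_eq := by
    rw [Walk.length_reverse, add_comm]
    exact (hf.of_subset (p.edges_takeUntil_subset_edges ha)).length_eq

theorem Walk.IsPath.isArm_dropUntil (hp : p.IsPath)
    (hf : p.ProperlyColored f) (hd : d ∈ W)
    (hW : ∀ x ∈ p.support, x ∈ W → x = c ∨ x = d) {a : V} (ha : a ∈ p.support) (hac : a ≠ c) :
    (p.dropUntil a ha).IsArm f (W ∪ {x | x ∈ p.support}) W where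
  isPath := hp.dropUntil ha
  subset x hx := Or.inr (p.support_dropUntil_subset_support ha hx)
  end_mem := hd
  eq_end x hx hxW := by
    refine (hW x (p.support_dropUntil_subset_support ha hx) hxW).resolve_left ?_
    rintro rfl
    exact hac (hp.eq_of_mem_takeUntil_of_mem_dropUntil ha (Walk.start_mem_support _) hx).symm
  length_eq := (hf.of_subset (p.edges_dropUntil_subset_edges ha)).length_eq

/-- Any two vertices of `W` with an ear attached are joined to `W` by disjoint arms. -/
theorem Walk.IsPath.hasArms (hp : p.IsPath)
    (hf : p.ProperlyColored f) (hc : c ∈ W) (hd : d ∈ W) (hcd : c ≠ d)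
    (hW : ∀ x ∈ p.support, x ∈ W → x = c ∨ x = d) {a b : V}
    (ha : a ∈ W ∪ {x | x ∈ p.support}) (hb : b ∈ W ∪ {x | x ∈ p.support}) (hab : a ≠ b) :
    G.HasArms f (W ∪ {x | x ∈ p.support}) W a b := by
  have mixed : ∀ a b : V, a ∈ p.support → a ∉ W → b ∈ W →
      G.HasArms f (W ∪ {x | x ∈ p.support}) W a b := by
    intro a b ha haW hb
    have hac : a ≠ c := by rintro rfl; exact haW hc
    have had : a ≠ d := by rintro rfl; exact haW hd
    by_cases hbc : b = c
    · have harm := hp.isArm_dropUntil hf hd hW ha hac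
      refine ⟨d, b, _, Walk.nil, harm, .nil (Or.inl hb) hb, ?_⟩
      intro x hx hx'
      rw [Walk.support_nil, List.mem_singleton] at hx'
      subst hx'
      exact hcd (hbc ▸ harm.eq_end x hx hb)
    · have harm := hp.isArm_takeUntil_reverse hf hc hW ha had
      refine ⟨c, b, _, Walk.nil, harm, .nil (Or.inl hb) hb, ?_⟩
      intro x hx hx'
      rw [Walk.support_nil, List.mem_singleton] at hx'
      subst hx'
      exact hbc (harm.eq_end x hx hb)
  have inner : ∀ a b : V, a ∉ W → b ∉ W → ∀ hb : b ∈ p.support,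
      a ∈ (p.takeUntil b hb).support → a ≠ b → G.HasArms f (W ∪ {x | x ∈ p.support}) W a b := by
    intro a b haW hbW hb ha hab
    have ha' := p.support_takeUntil_subset_support hb ha
    have had : a ≠ d := by rintro rfl; exact haW hd
    have hbc : b ≠ c := by rintro rfl; exact hbW hc
    refine ⟨c, d, _, _, hp.isArm_takeUntil_reverse hf hc hW ha' had,
      hp.isArm_dropUntil hf hd hW hb hbc, ?_⟩
    intro x hx hx'
    rw [Walk.support_reverse, List.mem_reverse, ← p.takeUntil_takeUntil hb ha] at hx
    obtain rfl := hp.eq_of_mem_takeUntil_of_mem_dropUntil hb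
      (Walk.support_takeUntil_subset_support _ _ hx) hx'
    exact Walk.endpoint_notMem_support_takeUntil (hp.takeUntil hb) ha hab.symm hx
  by_cases haW : a ∈ W <;> by_cases hbW : b ∈ W
  · refine ⟨a, b, Walk.nil, Walk.nil, .nil (Or.inl haW) haW, .nil (Or.inl hbW) hbW, ?_⟩
    simpa using hab.symm
  · exact (mixed b a (hb.resolve_left hbW) hbW haW).symm
  · exact mixed a b (ha.resolve_left haW) haW hbW
  · have ha' := ha.resolve_left haW
    have hb' := hb.resolve_left hbW
    rcases p.mem_takeUntil_or_mem_takeUntil ha' hb' with h | h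
    · exact inner a b haW hbW hb' h hab
    · exact (inner b a hbW haW ha' h hab.symm).symm

end Ear


/-- In a 2-connected graph every proper vertex set with at least two vertices has an ear. -/
theorem _root_.TwoConnected.exists_ear [Fintype V] [DecidableEq V] (hG : TwoConnected G)
    {W : Set V} (hWne : W ≠ Set.univ) (hW : ∀ x, ∃ y ∈ W, y ≠ x) :
    ∃ (c d : V) (p : G.Walk c d), p.IsPath ∧ c ∈ W ∧ d ∈ W ∧ c ≠ d ∧
      (∀ x ∈ p.support, x ∈ W → x = c ∨ x = d) ∧ ∃ x ∈ p.support, x ∉ W := by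
  classical
  obtain ⟨x, hx⟩ := (Set.ne_univ_iff_exists_notMem W).mp hWne
  obtain ⟨w, hw, -⟩ := hW x
  obtain ⟨q⟩ := hG.1.preconnected w x
  obtain ⟨⟨⟨c, x'⟩, hadj⟩, -, hc, hx'⟩ := q.exists_boundary_dart W hw hx
  replace hadj : G.Adj c x' := hadj
  replace hc : c ∈ W := hc
  replace hx' : x' ∉ W := hx'
  obtain ⟨y, hy, hyc⟩ := hW c
  obtain ⟨p⟩ := (hG.2.2 c).preconnected ⟨x', ⟨trivial, hadj.ne'⟩⟩ ⟨y, ⟨trivial, hyc⟩⟩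
  let p' : G.Walk x' y := p.map (Subgraph.hom _)
  have hcp : c ∉ p'.support := by
    intro h
    have hmem : c ∈ p.support.map (Subgraph.hom _) := by
      rw [← Walk.support_map]
      exact h
    obtain ⟨z, -, hz⟩ := List.mem_map.mp hmem
    exact z.2.2 hz
  obtain ⟨d, hd, hdp, hfirst⟩ := p'.bypass.exists_mem_support_forall_mem_support_imp_eq
    W.toFinset ⟨y, by simp [hy]⟩
  rw [Set.mem_toFinset] at hd
  have hcr : c ∉ (p'.bypass.takeUntil d hdp).support := fun h =>
    hcp (p'.support_bypass_subset_support (Walk.support_takeUntil_subset_support _ _ h))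
  refine ⟨c, d, Walk.cons hadj (p'.bypass.takeUntil d hdp), ?_, hc, hd, ?_, ?_, x', ?_, hx'⟩
  · exact (Walk.cons_isPath_iff _ _).mpr ⟨p'.bypass_isPath.takeUntil hdp, hcr⟩
  · rintro rfl
    exact hcr (Walk.end_mem_support _)
  · intro z hz hzW
    rw [Walk.support_cons, List.mem_cons] at hz
    exact hz.imp_right fun hz => hfirst z (by simpa using hzW) hz
  · simp

section Theta

variable [DecidableEq V]

/-- the span of the incidence vectors of the odd circuits -/
def oddCircuitSpan (G : SimpleGraph V) : Submodule (ZMod 2) (Sym2 V → ZMod 2) :=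
  Submodule.span (ZMod 2) {x | ∃ C, IsCircuitSet G C ∧ Odd C.card ∧ x = edgeInd C}

theorem Walk.IsCycle.edgeInd_mem_oddCircuitSpan {u : V} {c : G.Walk u u} (hc : c.IsCycle)
    (hodd : Odd c.length) :
    (fun e => (c.edges.count e : ZMod 2)) ∈ oddCircuitSpan G := by
  refine Submodule.subset_span ⟨c.edges.toFinset, ⟨u, c, hc, rfl⟩, ?_,
    (edgeInd_toFinset hc.edges_nodup).symm⟩
  rwa [List.toFinset_card_of_nodup hc.edges_nodup, Walk.length_edges]

/-- A properly coloured circuit with a chordal path of the wrong parity is the sum of two odd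
circuits. -/
theorem Walk.IsCycle.edgeInd_mem_oddCircuitSpan_of_chord {u : V} {c : G.Walk u u}
    (hc : c.IsCycle) {f : V → ZMod 2} (hf : c.ProperlyColored f) {a b : V} {p : G.Walk a b}
    (hp : p.IsPath) (hab : a ≠ b) (ha : a ∈ c.support) (hb : b ∈ c.support)
    (hpc : ∀ x ∈ p.support, x ∈ c.support → x = a ∨ x = b)
    (hlen : (p.length : ZMod 2) ≠ f a + f b) :
    edgeInd c.edges.toFinset ∈ oddCircuitSpan G := by
  have hb' : b ∈ (c.rotate a ha).support := by simpa using hb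
  obtain ⟨q, r, hqr⟩ := Walk.mem_support_iff_exists_append.mp hb'
  have hcyc : (q.append r).IsCycle := hqr ▸ hc.rotate ha
  have hqpath : q.IsPath := hcyc.isPath_of_append_left (Walk.not_nil_of_ne hab.symm)
  have hrpath : r.IsPath := hcyc.isPath_of_append_right (Walk.not_nil_of_ne hab)
  have hperm : (q.append r).edges.Perm c.edges := hqr ▸ (c.rotate_edges a ha).perm
  have hfqr : (q.append r).ProperlyColored f := hf.of_subset hperm.subset
  have hq := (hfqr.of_subset (q := q) (by simp [Walk.edges_append])).length_eq
  have hr := (hfqr.of_subset (q := r) (by simp [Walk.edges_append])).length_eq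
  have hsupp : ∀ x, x ∈ q.support ∨ x ∈ r.support → x ∈ c.support := by
    intro x hx
    rw [← Walk.mem_support_append_iff, ← hqr] at hx
    simpa using hx
  have hp1 : (p.length : ZMod 2) = f a + f b + 1 := by
    generalize (p.length : ZMod 2) = x at hlen ⊢
    generalize f a + f b = y at hlen ⊢
    decide +revert
  have odd1 : Odd (q.length + p.reverse.length) := by
    rw [← ZMod.natCast_eq_one_iff_odd, Nat.cast_add, Walk.length_reverse, hq, hp1, ← add_assoc,
      CharTwo.add_self_eq_zero, zero_add]
  have odd2 : Odd (p.length + r.length) := by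
    rw [← ZMod.natCast_eq_one_iff_odd, Nat.cast_add, hr, hp1, add_comm (f b), add_right_comm,
      CharTwo.add_self_eq_zero, zero_add]
  have h1 := hqpath.isCycle_append_of_odd hp.reverse hab odd1 fun x hx hx' =>
    hpc x (by simpa using hx') (hsupp x (Or.inl hx))
  have h2 := hp.isCycle_append_of_odd hrpath hab odd2 fun x hx hx' =>
    hpc x hx (hsupp x (Or.inr hx'))
  have hsum := add_mem (h1.edgeInd_mem_oddCircuitSpan (by rwa [Walk.length_append]))
    (h2.edgeInd_mem_oddCircuitSpan (by rwa [Walk.length_append]))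
  convert hsum using 1
  rw [edgeInd_toFinset hc.edges_nodup]
  funext e
  rw [Pi.add_apply, ← hperm.count_eq e]
  simp only [Walk.edges_append, Walk.edges_reverse, List.count_append, List.count_reverse,
    Nat.cast_add]
  linear_combination -(p.edges.count e : ZMod 2) * (CharTwo.two_eq_zero : (2 : ZMod 2) = 0)

/-- A path attached to a set joined to the circuit `c` by arms either has the right parity, or
exhibits `c` as a sum of two odd circuits. -/
theorem Walk.IsCycle.length_eq_of_hasArms {u : V} {c : G.Walk u u} (hc : c.IsCycle)
    (hcS : edgeInd c.edges.toFinset ∉ oddCircuitSpan G) {f : V → ZMod 2}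
    (hf : c.ProperlyColored f) {W : Set V} (hcW : {x | x ∈ c.support} ⊆ W) {x y : V}
    (harms : G.HasArms f W {x | x ∈ c.support} x y) {p : G.Walk x y} (hp : p.IsPath)
    (hpW : ∀ z ∈ p.support, z ∈ W → z = x ∨ z = y) : (p.length : ZMod 2) = f x + f y := by
  obtain ⟨s, t, r, q, hr, hq, hd⟩ := harms
  by_contra hne
  have hpq : (p.append q).IsPath := by
    refine hp.append_of_forall_eq hq.isPath fun z hz hz' => ?_
    refine (hpW z hz (hq.subset z hz')).resolve_left ?_
    rintro rfl
    exact hd r.start_mem_support hz'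
  have hrpq : (r.reverse.append (p.append q)).IsPath := by
    refine hr.isPath.reverse.append_of_forall_eq hpq fun z hz hz' => ?_
    rw [Walk.support_reverse, List.mem_reverse] at hz
    rw [Walk.mem_support_append_iff] at hz'
    rcases hz' with hz' | hz'
    · refine (hpW z hz' (hr.subset z hz)).resolve_right ?_
      rintro rfl
      exact hd hz q.start_mem_support
    · exact (hd hz hz').elim
  have hst : s ≠ t := by
    rintro rfl
    exact hd r.end_mem_support q.end_mem_support
  refine hcS (hc.edgeInd_mem_oddCircuitSpan_of_chord hf hrpq hst hr.end_mem hq.end_mem ?_ ?_)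
  · intro z hz hzc
    rw [Walk.mem_support_append_iff, Walk.mem_support_append_iff, Walk.support_reverse,
      List.mem_reverse] at hz
    rcases hz with hz | hz | hz
    · exact Or.inl (hr.eq_end z hz hzc)
    · rcases hpW z hz (hcW hzc) with rfl | rfl
      · exact Or.inl (hr.eq_end _ r.start_mem_support hzc)
      · exact Or.inr (hq.eq_end _ q.start_mem_support hzc)
    · exact Or.inr (hq.eq_end z hz hzc)
  · intro h
    apply hne
    rw [Walk.length_append, Walk.length_append, Walk.length_reverse, Nat.cast_add, Nat.cast_add,
      hr.length_eq, hq.length_eq] at h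
    linear_combination h - (f x + f y) * (CharTwo.two_eq_zero : (2 : ZMod 2) = 0)

theorem _root_.TwoConnected.edgeInd_mem_of_even [Fintype V] (hG : TwoConnected G) (hnb : HasOddCircuit G)
    {u : V} {c : G.Walk u u} (hc : c.IsCycle) (heven : Even c.length) :
    edgeInd c.edges.toFinset ∈ oddCircuitSpan G := by
  by_contra hcS
  obtain ⟨f, hf⟩ := hc.exists_properlyColored heven
  suffices ∀ (W : Set V) (f : V → ZMod 2), {x | x ∈ c.support} ⊆ W → c.ProperlyColored f →
      ¬ ∀ a ∈ W, ∀ b ∈ W, a ≠ b → G.HasArms f W {x | x ∈ c.support} a b by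
    refine this _ f subset_rfl hf fun a ha b hb hab => ?_
    exact ⟨a, b, Walk.nil, Walk.nil, .nil ha ha, .nil hb hb, by simpa using hab.symm⟩
  clear hf f
  intro W
  induction W using WellFoundedGT.induction with
  | ind W ih =>
  intro f hcW hf harms
  by_cases hWuniv : W = Set.univ
  · subst hWuniv
    obtain ⟨v, o, -, hodd⟩ := hnb
    have ho : o.ProperlyColored f := by
      intro x y hxy
      have hadj := o.adj_of_mem_edges hxy
      have := hc.length_eq_of_hasArms hcS hf hcW (harms x trivial y trivial hadj.ne)
        (p := hadj.toWalk) (by simp [hadj.ne]) (by simp)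
      rw [Walk.length_cons, Walk.length_nil, zero_add, Nat.cast_one] at this
      linear_combination -this - f y * (CharTwo.two_eq_zero : (2 : ZMod 2) = 0)
    have := ho.length_eq
    rw [CharTwo.add_self_eq_zero, ZMod.natCast_eq_one_iff_odd.mpr hodd] at this
    exact one_ne_zero this
  · have hW2 : ∀ x, ∃ y ∈ W, y ≠ x := by
      intro x
      by_cases hxu : u = x
      · refine ⟨c.snd, hcW (c.getVert_mem_support 1), ?_⟩
        rw [← hxu]
        exact (c.adj_snd hc.not_nil).ne'
      · exact ⟨u, hcW c.start_mem_support, hxu⟩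
    obtain ⟨y, z, p, hp, hy, hz, hyz, hpW, v, hv, hvW⟩ := hG.exists_ear hWuniv hW2
    have hlen := hc.length_eq_of_hasArms hcS hf hcW (harms y hy z hz hyz) hp hpW
    obtain ⟨f', hf', hpf'⟩ := hp.exists_properlyColored f
    have hff' : ∀ x ∈ W, f' x = f x := by
      intro x hx
      by_cases hxp : x ∈ p.support
      · rcases hpW x hxp hx with rfl | rfl
        · have := hpf'.length_eq
          rw [hlen, hf' z (Or.inr rfl)] at this
          exact (add_right_cancel this).symm
        · exact hf' _ (Or.inr rfl)
      · exact hf' x (Or.inl hxp)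
    have hlt : W < W ∪ {x | x ∈ p.support} :=
      Set.ssubset_iff_subset_ne.mpr ⟨Set.subset_union_left, fun h => hvW (h ▸ Or.inr hv)⟩
    refine ih _ hlt f' (hcW.trans hlt.le) ?_ ?_
    · intro x x' hxx'
      rw [hff' x (hcW (c.fst_mem_support_of_mem_edges hxx')),
        hff' x' (hcW (c.snd_mem_support_of_mem_edges hxx'))]
      exact hf x x' hxx'
    · intro a ha b hb hab
      exact (hp.hasArms hpf' hy hz hyz hpW ha hb hab).trans harms hlt.le hcW hff'

/-- In a 2-connected non-bipartite graph the odd circuits generate the cycle space. -/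
theorem _root_.TwoConnected.oddCircuitSpan_eq [Fintype V] (hG : TwoConnected G) (hnb : HasOddCircuit G) :
    oddCircuitSpan G = cycleSpace G := by
  apply le_antisymm
  · exact Submodule.span_mono fun x ⟨C, hC, _, hx⟩ => ⟨C, hC, hx⟩
  · refine Submodule.span_le.mpr ?_
    rintro _ ⟨C, hC, rfl⟩
    by_cases hodd : Odd C.card
    · exact Submodule.subset_span ⟨C, hC, hodd, rfl⟩
    · obtain ⟨u, c, hc, rfl⟩ := hC
      rw [List.toFinset_card_of_nodup hc.edges_nodup, Walk.length_edges,
        Nat.not_odd_iff_even] at hodd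
      exact hG.edgeInd_mem_of_even hnb hc hodd

end Theta

end SimpleGraph

section Parity

variable [Fintype V] [DecidableEq V]

theorem sum_edgeInd_mul (C D : Finset (Sym2 V)) :
    ∑ e, edgeInd C e * edgeInd D e = ((C ∩ D).card : ZMod 2) := by
  simp [edgeInd, ← ite_and, ← Finset.mem_inter, Finset.inter_comm]

theorem sum_edgeInd (C : Finset (Sym2 V)) : ∑ e, edgeInd C e = (C.card : ZMod 2) := by
  simp [edgeInd]

/-- If the members of a family of odd edge sets pairwise share an odd number of edges, then so do
all odd edge sets in its span. -/
theorem odd_card_inter_of_mem_span {T : Set (Finset (Sym2 V))} (hodd : ∀ C ∈ T, Odd C.card)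
    (hT : ∀ C ∈ T, ∀ D ∈ T, C ≠ D → Odd (C ∩ D).card) {C D : Finset (Sym2 V)}
    (hC : edgeInd C ∈ Submodule.span (ZMod 2) (edgeInd '' T))
    (hD : edgeInd D ∈ Submodule.span (ZMod 2) (edgeInd '' T))
    (hCodd : Odd C.card) (hDodd : Odd D.card) : Odd (C ∩ D).card := by
  have key : ∀ x y : Sym2 V → ZMod 2, x ∈ Submodule.span (ZMod 2) (edgeInd '' T) →
      y ∈ Submodule.span (ZMod 2) (edgeInd '' T) → ∑ e, x e * y e = (∑ e, x e) * ∑ e, y e := by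
    intro x y hx hy
    induction hx, hy using Submodule.span_induction₂ with
    | mem_mem x y hx hy =>
      obtain ⟨C, hC, rfl⟩ := hx
      obtain ⟨D, hD, rfl⟩ := hy
      rw [sum_edgeInd_mul, sum_edgeInd, sum_edgeInd, ZMod.natCast_eq_one_iff_odd.mpr (hodd C hC),
        ZMod.natCast_eq_one_iff_odd.mpr (hodd D hD), mul_one, ZMod.natCast_eq_one_iff_odd]
      by_cases hCD : C = D
      · rw [← hCD, Finset.inter_self]
        exact hodd C hC
      · exact hT C hC D hD hCD
    | zero_left => simp
    | zero_right => simp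
    | add_left x y z _ _ _ h1 h2 => simp [add_mul, Finset.sum_add_distrib, h1, h2]
    | add_right x y z _ _ _ h1 h2 => simp [mul_add, Finset.sum_add_distrib, h1, h2]
    | smul_left r x y _ _ h => simp [mul_assoc, ← Finset.mul_sum, h]
    | smul_right r x y _ _ h => simp [mul_left_comm, ← Finset.mul_sum, h]
  have := key _ _ hC hD
  rw [sum_edgeInd_mul, sum_edgeInd, sum_edgeInd, ZMod.natCast_eq_one_iff_odd.mpr hCodd,
    ZMod.natCast_eq_one_iff_odd.mpr hDodd, mul_one] at this
  exact ZMod.natCast_eq_one_iff_odd.mp this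

theorem TwoConnected.exists_odd_circuit_basis {G : SimpleGraph V} (hG : TwoConnected G)
    (hnb : HasOddCircuit G) :
    ∃ B : Finset (Finset (Sym2 V)), IsCycleBasis G B ∧
      ∀ C ∈ B, IsCircuitSet G C ∧ Odd C.card := by
  classical
  obtain ⟨b, hbs, hspan, hli⟩ := exists_linearIndependent (ZMod 2)
    {x : Sym2 V → ZMod 2 | ∃ C, IsCircuitSet G C ∧ Odd C.card ∧ x = edgeInd C}
  have hmem : ∀ C : Finset (Sym2 V), edgeInd C ∈ b → IsCircuitSet G C ∧ Odd C.card := by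
    intro C hC
    obtain ⟨D, hD, hDodd, hCD⟩ := hbs hC
    rw [edgeInd_injective hCD]
    exact ⟨hD, hDodd⟩
  have himage : edgeInd '' ((Finset.univ.filter fun C => edgeInd C ∈ b :
      Finset (Finset (Sym2 V))) : Set (Finset (Sym2 V))) = b := by
    ext x
    constructor
    · rintro ⟨C, hC, rfl⟩
      simpa using hC
    · intro hx
      obtain ⟨C, -, -, rfl⟩ := hbs hx
      exact ⟨C, by simpa using hx, rfl⟩
  refine ⟨Finset.univ.filter fun C => edgeInd C ∈ b, ⟨?_, ?_, ?_⟩, ?_⟩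
  · intro C hC
    exact Submodule.subset_span ⟨C, (hmem C (by simpa using hC)).1, rfl⟩
  · let g : (Finset.univ.filter fun C => edgeInd C ∈ b : Finset (Finset (Sym2 V))) → b :=
      fun C => ⟨edgeInd C.1, (Finset.mem_filter.mp C.2).2⟩
    have hg : Function.Injective g := fun C D h =>
      Subtype.ext (edgeInd_injective (congrArg Subtype.val h))
    exact hli.comp g hg
  · rw [himage, hspan]
    exact hG.oddCircuitSpan_eq hnb
  · intro C hC
    exact hmem C (by simpa using hC)

end Parity


/-- for a 2-connected non-bipartite graph the following are
equivalent: (i) any two odd circuits share an odd number of edges; (ii) there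
is a totally odd circuit basis; (iii) every odd cycle basis is totally odd. -/
theorem stmt3 {V : Type*} [Fintype V] [DecidableEq V] (G : SimpleGraph V)
    (hG : TwoConnected G) (hnb : HasOddCircuit G) :
    ((∀ C D : Finset (Sym2 V), IsCircuitSet G C → IsCircuitSet G D →
        Odd C.card → Odd D.card → Odd (C ∩ D).card) ↔
      (∃ B : Finset (Finset (Sym2 V)), IsCycleBasis G B ∧
        (∀ C ∈ B, IsCircuitSet G C ∧ Odd C.card) ∧
        ∀ C ∈ B, ∀ D ∈ B, C ≠ D → Odd (C ∩ D).card)) ∧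
    ((∀ C D : Finset (Sym2 V), IsCircuitSet G C → IsCircuitSet G D →
        Odd C.card → Odd D.card → Odd (C ∩ D).card) ↔
      (∀ B : Finset (Finset (Sym2 V)), IsCycleBasis G B →
        (∀ C ∈ B, Odd C.card) →
        ∀ C ∈ B, ∀ D ∈ B, C ≠ D → Odd (C ∩ D).card)) := by
  obtain ⟨B₀, hB₀, hB₀odd⟩ := hG.exists_odd_circuit_basis hnb
  have totally_odd : ∀ B : Finset (Finset (Sym2 V)), IsCycleBasis G B → (∀ C ∈ B, Odd C.card) →
      (∀ C ∈ B, ∀ D ∈ B, C ≠ D → Odd (C ∩ D).card) →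
      ∀ C D : Finset (Sym2 V), IsCycleSet G C → IsCycleSet G D →
        Odd C.card → Odd D.card → Odd (C ∩ D).card := by
    intro B hB hodd hBB C D hC hD
    rw [IsCycleSet, ← hB.2.2] at hC hD
    exact odd_card_inter_of_mem_span (T := (B : Set (Finset (Sym2 V)))) hodd hBB hC hD
  have circuit : ∀ C, IsCircuitSet G C → IsCycleSet G C :=
    fun C hC => Submodule.subset_span ⟨C, hC, rfl⟩
  refine ⟨⟨fun h => ⟨B₀, hB₀, hB₀odd, fun C hC D hD _ => ?_⟩, ?_⟩, fun h B hB hodd C hC D hD _ => ?_,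
    fun h C D hC hD => ?_⟩
  · exact h C D (hB₀odd C hC).1 (hB₀odd D hD).1 (hB₀odd C hC).2 (hB₀odd D hD).2
  · rintro ⟨B, hB, hodd, hBB⟩ C D hC hD
    exact totally_odd B hB (fun C hC => (hodd C hC).2) hBB C D (circuit C hC) (circuit D hD)
  · exact totally_odd B₀ hB₀ (fun C hC => (hB₀odd C hC).2)
      (fun C hC D hD _ => h C D (hB₀odd C hC).1 (hB₀odd D hD).1 (hB₀odd C hC).2 (hB₀odd D hD).2)
      C D (hB.1 C hC) (hB.1 D hD) (hodd C hC) (hodd D hD)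
  · have hodd : ∀ C ∈ B₀, Odd C.card := fun C hC => (hB₀odd C hC).2
    exact totally_odd B₀ hB₀ hodd (h B₀ hB₀ hodd) C D (circuit C hC) (circuit D hD)
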